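/- arXiv:0710.1502 — 8 statements merged into one kernel-verified Lean document; each statement's English description precedes it below -/
import Mathlib

section
/- Let d ≥ 2 be an integer, let q be an integer with q ≥ d − 1, let G be a finite abelian group, and let φ : ℤ/qℤ → G be a differentially 1-uniform function. Let p be a prime number not dividing d (the paper takes p to be the least prime coprime to d). Define φ_d : ℤ/dℤ → G by φ_d(i) = φ(i mod q) where each i ∈ ℤ/dℤ is represented by its least nonnegative residue 0 ≤ i ≤ d−1, and define f : ℤ/dℤ → ℤ/pℤ × G by f(i) = (i mod p, φ_d(i)), again representing i by its least nonnegative residue. Then f is differentially 1-uniform. -/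
/-- A function `f : A → B` between (finite) abelian groups is differentially 1-uniform:
for every `(a, b) ≠ (0, 0)`, the equation `f (x + a) - f x = b` has at most one solution `x`. -/
def IsD1U {A B : Type} [AddCommGroup A] [AddCommGroup B] (f : A → B) : Prop :=
  ∀ a : A, ∀ b : B, (a, b) ≠ (0, 0) →
    ∀ x y : A, f (x + a) - f x = b → f (y + a) - f y = b → x = y

theorem natCast_small_eq {q d X Y : ℕ} (hd : 2 ≤ d) (hq : d - 1 ≤ q) (hX : X < d) (hY : Y < d)
    (h : (X : ZMod q) = Y) : X = Y ∨ (X = 0 ∧ Y + 1 = d) ∨ (Y = 0 ∧ X + 1 = d) := by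
  rw [ZMod.natCast_eq_natCast_iff] at h
  rcases le_total X Y with hl | hl
  · have h1 := (Nat.modEq_iff_dvd' hl).1 h
    rcases Nat.eq_zero_or_pos (Y - X) with h0 | h0
    · omega
    · have := Nat.le_of_dvd h0 h1
      omega
  · have h1 := (Nat.modEq_iff_dvd' hl).1 h.symm
    rcases Nat.eq_zero_or_pos (X - Y) with h0 | h0
    · omega
    · have := Nat.le_of_dvd h0 h1
      omega

/-- Proposition 5 of the paper: if `φ : ℤ/qℤ → G` is d1u with `q ≥ d - 1` and `p` is a prime
not dividing `d`, then `i ↦ (i mod p, φ (i mod q))` (with `i` the least nonnegative residue)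
is a d1u function `ℤ/dℤ → ℤ/pℤ × G`. -/
theorem d1u_of_prime_times_restriction
    (d q : ℕ) (hd : 2 ≤ d) (hq : d - 1 ≤ q)
    (G : Type) [AddCommGroup G] [Fintype G]
    (φ : ZMod q → G) (hφ : IsD1U φ)
    (p : ℕ) (hp : p.Prime) (hpd : ¬ p ∣ d) :
    IsD1U (fun i : ZMod d => (((i.val : ZMod p), φ (i.val : ZMod q)) : ZMod p × G)) := by
  haveI : NeZero d := ⟨by omega⟩
  intro a b hab x y hx hy
  have hXd := ZMod.val_lt x
  have hYd := ZMod.val_lt y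
  have hAd := ZMod.val_lt a
  have hA0 : a.val ≠ 0 := by
    intro h0
    have ha : a = 0 := (ZMod.val_eq_zero a).1 h0
    subst ha
    apply hab
    simp at hx
    rw [← hx]
  have hwrap : ∀ z : ZMod d, (z.val + a.val < d ∧ (z + a).val = z.val + a.val) ∨
      (d ≤ z.val + a.val ∧ (z + a).val + d = z.val + a.val) := by
    intro z
    rcases lt_or_ge (z.val + a.val) d with h | h
    · exact Or.inl ⟨h, ZMod.val_add_of_lt h⟩
    · exact Or.inr ⟨h, ZMod.val_add_val_of_le h |>.symm⟩
  have hdp : (d : ZMod p) ≠ 0 := by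
    rwa [Ne, ZMod.natCast_eq_zero_iff]
  obtain ⟨b1, b2⟩ := b
  simp only [Prod.mk_sub_mk, Prod.mk.injEq] at hx hy
  obtain ⟨hx1, hx2⟩ := hx
  obtain ⟨hy1, hy2⟩ := hy
  apply ZMod.val_injective d
  have key : ∀ A' : ZMod q, ((x + a).val : ZMod q) = x.val + A' →
      ((y + a).val : ZMod q) = y.val + A' → A' ≠ 0 → (x.val : ZMod q) = y.val := by
    intro A' e1 e2 hA
    rw [e1] at hx2
    rw [e2] at hy2
    exact hφ A' b2 (fun h => hA (Prod.mk.inj h).1) _ _ hx2 hy2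
  rcases hwrap x with ⟨h1, e1⟩ | ⟨h1, e1⟩ <;> rcases hwrap y with ⟨h2, e2⟩ | ⟨h2, e2⟩
  · by_cases hA : (a.val : ZMod q) = 0
    · rcases natCast_small_eq (Y := 0) hd hq hAd (by omega) (by simpa using hA) with h | h | h <;>
        omega
    · have h := key a.val (by rw [e1]; push_cast; rfl) (by rw [e2]; push_cast; rfl) hA
      rcases natCast_small_eq hd hq hXd hYd h with h | h | h <;> omega
  · exfalso
    have c1 := congrArg (Nat.cast : ℕ → ZMod p) e1
    have c2 := congrArg (Nat.cast : ℕ → ZMod p) e2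
    push_cast at c1 c2
    apply hdp
    linear_combination c2 - c1 + hx1 - hy1
  · exfalso
    have c1 := congrArg (Nat.cast : ℕ → ZMod p) e1
    have c2 := congrArg (Nat.cast : ℕ → ZMod p) e2
    push_cast at c1 c2
    apply hdp
    linear_combination c1 - c2 + hy1 - hx1
  · have c1 := congrArg (Nat.cast : ℕ → ZMod q) e1
    have c2 := congrArg (Nat.cast : ℕ → ZMod q) e2
    push_cast at c1 c2
    by_cases hA : (a.val : ZMod q) - d = 0
    · have h3 : ((d - a.val : ℕ) : ZMod q) = (0 : ℕ) := by
        rw [Nat.cast_sub hAd.le]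
        push_cast
        linear_combination -hA
      rcases natCast_small_eq hd hq (by omega) (by omega) h3 with h | h | h <;> omega
    · have h := key (a.val - d) (by linear_combination c1) (by linear_combination c2) hA
      rcases natCast_small_eq hd hq hXd hYd h with h | h | h <;> omega
end

section
/- Let d ≥ 2 be an even integer, let q be an integer with q ≥ d − 1, let G be a finite abelian group, and let φ : ℤ/qℤ → G be a differentially 1-uniform function. Define the flag function θ : ℤ/dℤ → ℤ/3ℤ by θ(x) = 0 if the least nonnegative residue of x satisfies 0 ≤ x ≤ d/2 − 1, and θ(x) = 1 if d/2 ≤ x ≤ d − 1. Define φ_d : ℤ/dℤ → G by φ_d(i) = φ(i mod q), representing i by its least nonnegative residue, and define f : ℤ/dℤ → ℤ/3ℤ × G by f(i) = (θ(i), φ_d(i)). Then f is differentially 1-uniform. -/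
lemma d1u_aux (d q : ℕ) (hd : 2 ≤ d) (hq : d - 1 ≤ q)
    (G : Type) [AddCommGroup G] (φ : ZMod q → G) (hφ : IsD1U φ)
    (x y s : ℕ) (hs : 1 ≤ s) (hx : x + s < d) (hy : y + s < d)
    (h : φ ((x + s : ℕ) : ZMod q) - φ (x : ZMod q)
      = φ ((y + s : ℕ) : ZMod q) - φ (y : ZMod q)) : x = y := by
  by_cases hsq : s < q
  · have hne : (s : ZMod q) ≠ 0 := by
      intro h0
      rw [ZMod.natCast_eq_zero_iff] at h0
      have := Nat.le_of_dvd (by omega) h0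
      omega
    have := hφ (s : ZMod q) (φ ((y + s : ℕ) : ZMod q) - φ (y : ZMod q))
      (fun e => hne (Prod.mk.inj e).1) (x : ZMod q) (y : ZMod q)
      (by rw [← h]; push_cast; rfl) (by push_cast; rfl)
    rw [ZMod.natCast_eq_natCast_iff] at this
    exact Nat.ModEq.eq_of_lt_of_lt this (by omega) (by omega)
  · omega

theorem d1u_of_flag_times_restriction
    (d q : ℕ) (hd : 2 ≤ d) (hev : Even d) (hq : d - 1 ≤ q)
    (G : Type) [AddCommGroup G] [Fintype G]
    (φ : ZMod q → G) (hφ : IsD1U φ) :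
    IsD1U (fun i : ZMod d =>
      (((if i.val < d / 2 then 0 else 1 : ZMod 3), φ (i.val : ZMod q)) : ZMod 3 × G)) := by
  have : NeZero d := ⟨by omega⟩
  intro a b hab x y hx hy
  have key := hx.trans hy.symm
  obtain ⟨h1, h2⟩ := Prod.mk.inj key
  dsimp only at h1 h2
  by_cases ha : a = 0
  · exfalso
    apply hab
    subst ha
    simp at hx
    rw [← hx]
  have ha0 : a.val ≠ 0 := by rwa [Ne, ZMod.val_eq_zero]
  have hal := ZMod.val_lt a
  have hxl := ZMod.val_lt x
  have hyl := ZMod.val_lt y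
  have e01 : (0 : ZMod 3) - 1 ≠ 0 := by decide
  have e10 : (1 : ZMod 3) - 0 ≠ 0 := by decide
  have e2 : (1 : ZMod 3) - 0 ≠ 0 - 1 := by decide
  have e3 : (0 : ZMod 3) - 1 ≠ 1 - 0 := by decide
  obtain ⟨m, hm⟩ := hev
  have hm2 : d / 2 = m := by omega
  rw [hm2] at h1
  apply ZMod.val_injective d
  have wx : (x.val + a.val < d ∧ (x + a).val = x.val + a.val) ∨
      (d ≤ x.val + a.val ∧ (x + a).val + d = x.val + a.val) := by
    rcases lt_or_ge (x.val + a.val) d with h | h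
    · exact Or.inl ⟨h, ZMod.val_add_of_lt h⟩
    · exact Or.inr ⟨h, (ZMod.val_add_val_of_le h).symm⟩
  have wy : (y.val + a.val < d ∧ (y + a).val = y.val + a.val) ∨
      (d ≤ y.val + a.val ∧ (y + a).val + d = y.val + a.val) := by
    rcases lt_or_ge (y.val + a.val) d with h | h
    · exact Or.inl ⟨h, ZMod.val_add_of_lt h⟩
    · exact Or.inr ⟨h, (ZMod.val_add_val_of_le h).symm⟩
  generalize (x + a).val = X at *
  generalize (y + a).val = Y at *
  generalize x.val = u at *
  generalize y.val = v at *
  generalize a.val = s at *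
  rcases wx with ⟨hx1, hx2⟩ | ⟨hx1, hx2⟩ <;> rcases wy with ⟨hy1, hy2⟩ | ⟨hy1, hy2⟩
  · subst hx2 hy2
    exact d1u_aux d q hd hq G φ hφ u v s (by omega) hx1 hy1 h2
  · exfalso
    split_ifs at h1 <;> first | omega | (simp at h1; done) | exact e2 h1 | exact e3 h1
  · exfalso
    split_ifs at h1 <;> first | omega | (simp at h1; done) | exact e2 h1 | exact e3 h1
  · have hu : u = X + (d - s) := by omega
    have hv : v = Y + (d - s) := by omega
    have := d1u_aux d q hd hq G φ hφ X Y (d - s) (by omega) (by omega) (by omega) (by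
      rw [← hu, ← hv, ← neg_sub, h2, neg_sub])
    omega
end

section
/- Let d ≥ 3 be an odd integer. Then for every integer q ≥ d − 1, one has 𝐂(d) ≤ 2·𝐂(q). In particular 𝐂(d) ≤ 2·𝐂(q_d), where q_d is the smallest integer q ≥ d−1 minimizing 𝐂(q). -/
/-- `𝐂(d)`: the smallest cardinality of a finite abelian group `B` admitting a
differentially 1-uniform function `ℤ/dℤ → B`. -/
noncomputable def Cd1u (d : ℕ) : ℕ :=
  sInf {n : ℕ | ∃ (B : Type) (_ : AddCommGroup B) (_ : Fintype B),
    Fintype.card B = n ∧ ∃ f : ZMod d → B, IsD1U f}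

/-- The set defining `Cd1u q` is nonempty for `q ≠ 0`. -/
theorem exists_d1u (q : ℕ) [NeZero q] : ∃ n : ℕ, ∃ (B : Type) (_ : AddCommGroup B) (_ : Fintype B),
    Fintype.card B = n ∧ ∃ f : ZMod q → B, IsD1U f := by
  refine ⟨_, ZMod q → ZMod 3, inferInstance, inferInstance, rfl, fun x => Pi.single x 1, ?_⟩
  intro a b hab x y hx hy
  by_cases ha : a = 0
  · subst ha
    simp at hx
    simp [← hx] at hab
  · by_contra hne
    have h := congrFun (hx.trans hy.symm) x
    have h1 : x ≠ x + a := by simpa using ha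
    simp only [Pi.sub_apply, Pi.single_apply, if_true, if_neg h1, if_neg hne] at h
    split_ifs at h
    · exact (by decide : (0 : ZMod 3) - 1 ≠ 1 - 0) h
    · exact (by decide : (0 : ZMod 3) - 1 ≠ 0 - 0) h

theorem near_of_cast_eq {q d j l : ℕ} (hq : d - 1 ≤ q) (hj : j < d) (hl : l < d)
    (h : (j : ZMod q) = (l : ZMod q)) :
    j = l ∨ (j = 0 ∧ l = d - 1) ∨ (l = 0 ∧ j = d - 1) := by
  rw [ZMod.natCast_eq_natCast_iff] at h
  rcases le_total j l with hjl | hjl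
  · have h2 := (Nat.modEq_iff_dvd' hjl).1 h
    rcases Nat.eq_zero_or_pos (l - j) with h0 | h0
    · omega
    · have := Nat.le_of_dvd h0 h2
      omega
  · have h2 := (Nat.modEq_iff_dvd' hjl).1 h.symm
    rcases Nat.eq_zero_or_pos (j - l) with h0 | h0
    · omega
    · have := Nat.le_of_dvd h0 h2
      omega

theorem d1u_lift {d q : ℕ} (hd : 3 ≤ d) (hodd : Odd d) (hq : d - 1 ≤ q) {B : Type}
    [AddCommGroup B] (f : ZMod q → B) (hf : IsD1U f) :
    IsD1U (fun x : ZMod d => ((f (x.val : ZMod q), (x.val : ZMod 2)) : B × ZMod 2)) := by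
  have : NeZero d := ⟨by omega⟩
  intro a b hab x y hx hy
  have ha : a ≠ 0 := by
    rintro rfl
    simp at hx
    exact hab (by simp [← hx])
  have hxy := hx.trans hy.symm
  simp only [Prod.mk_sub_mk, Prod.mk.injEq] at hxy
  obtain ⟨h1, h2⟩ := hxy
  clear hx hy
  have hij : (x + a).val ≠ x.val := by
    intro h
    exact ha (by simpa using ZMod.val_injective d h)
  have hmod : (x + a).val + y.val ≡ (y + a).val + x.val [MOD d] := by
    rw [← ZMod.natCast_eq_natCast_iff]
    push_cast
    simp only [ZMod.natCast_zmod_val]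
    ring
  have hi := ZMod.val_lt (x + a)
  have hj := ZMod.val_lt x
  have hk := ZMod.val_lt (y + a)
  have hl := ZMod.val_lt y
  apply ZMod.val_injective d
  generalize (x + a).val = i at *
  generalize (y + a).val = k at *
  generalize x.val = j at *
  generalize y.val = l at *
  have hpar : i + l ≡ k + j [MOD 2] := by
    rw [← ZMod.natCast_eq_natCast_iff]
    push_cast
    linear_combination h2
  have hsum : i + l = k + j := by
    have hc : Nat.Coprime 2 d := Nat.coprime_two_left.2 hodd
    have h3 := (Nat.modEq_and_modEq_iff_modEq_mul hc).1 ⟨hpar, hmod⟩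
    exact Nat.ModEq.eq_of_lt_of_lt h3 (by omega) (by omega)
  have hcast : (i : ZMod q) + l = k + j := by exact_mod_cast congrArg (Nat.cast (R := ZMod q)) hsum
  by_cases hA : (i : ZMod q) = j
  · rcases near_of_cast_eq hq hi hj hA with h | h | h <;> omega
  · have hX : (j : ZMod q) = l := by
      refine hf ((i : ZMod q) - j) (f i - f j) ?_ _ _ ?_ ?_
      · intro h
        exact hA (sub_eq_zero.1 (Prod.mk.inj h).1)
      · rw [add_sub_cancel]
      · rw [h1]
        congr 2
        linear_combination hcast
    rcases near_of_cast_eq hq hj hl hX with h | h | h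
    · exact h
    · omega
    · omega

/-- Theorem 5(1) of the paper: for odd `d ≥ 3` and any `q ≥ d - 1`, `𝐂(d) ≤ 2·𝐂(q)`.
In particular `𝐂(d) ≤ 2·𝐂(q_d)` for `q_d` the smallest integer `≥ d - 1` minimizing `𝐂`. -/
theorem C_le_two_mul_C_of_odd (d : ℕ) (hd : 3 ≤ d) (hodd : Odd d) :
    ∀ q : ℕ, d - 1 ≤ q → Cd1u d ≤ 2 * Cd1u q := by
  intro q hq
  have : NeZero q := ⟨by omega⟩
  obtain ⟨B, _, _, hB, f, hf⟩ := Nat.sInf_mem (exists_d1u q)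
  refine Nat.sInf_le ⟨B × ZMod 2, inferInstance, inferInstance, ?_, _, d1u_lift hd hodd hq f hf⟩
  rw [Fintype.card_prod, hB, ZMod.card, mul_comm]
  rfl
end

section
/- There exists a constant c > 0 such that for every integer d ≥ 2, 𝐂(d) ≤ c·d; that is, 𝐂(d) = O(d). -/
/-- The function `x ↦ (x² mod p, [2x ≥ d])`, with `x` represented in `[0, d)`. -/
def quadHalf (d p : ℕ) (x : ZMod d) : ZMod p × ZMod 3 :=
  (((x.val : ℤ) ^ 2 : ℤ), if 2 * x.val < d then 0 else 1)

/-- Squares modulo a prime `p > d` have distinct differences on `[0, d)`. -/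
theorem quad_aux (d p : ℕ) (hd : 2 ≤ d) (hp : p.Prime) (hdp : d < p) (u v k : ℤ)
    (hk : k ≠ 0) (hk' : |k| < d) (huv : |u - v| < d)
    (h : (((u + k) ^ 2 : ℤ) : ZMod p) - ((u ^ 2 : ℤ) : ZMod p)
      = (((v + k) ^ 2 : ℤ) : ZMod p) - ((v ^ 2 : ℤ) : ZMod p)) : u = v := by
  have hpi : Prime (p : ℤ) := Nat.prime_iff_prime_int.mp hp
  have h1 : (p : ℤ) ∣ 2 * k * (u - v) := by
    apply (ZMod.intCast_zmod_eq_zero_iff_dvd _ p).mp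
    push_cast at h ⊢
    linear_combination h
  rcases hpi.dvd_or_dvd h1 with h2 | h2
  · rcases hpi.dvd_or_dvd h2 with h3 | h3
    · have := Int.le_of_dvd (by norm_num) h3
      omega
    · exact absurd (Int.eq_zero_of_abs_lt_dvd h3 (by omega)) hk
  · have := Int.eq_zero_of_abs_lt_dvd h2 (by omega)
    omega

theorem quadHalf_isD1U (d p : ℕ) (hd : 2 ≤ d) (hp : p.Prime) (hdp : d < p) :
    IsD1U (quadHalf d p) := by
  haveI : NeZero d := ⟨by omega⟩
  intro a b hab x y hx hy
  by_cases ha : a = 0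
  · exfalso
    subst ha
    apply hab
    simp at hx
    simp [← hx]
  have hA0 : a.val ≠ 0 := fun h => ha ((ZMod.val_eq_zero a).mp h)
  have hA := ZMod.val_lt a
  have hu := ZMod.val_lt x
  have hv := ZMod.val_lt y
  have hu' := ZMod.val_lt (x + a)
  have hv' := ZMod.val_lt (y + a)
  have key : ∀ z : ZMod d, (z + a).val = z.val + a.val ∨ (z + a).val + d = z.val + a.val := by
    intro z
    have hz := ZMod.val_lt z
    rcases lt_or_ge (z.val + a.val) d with h | h
    · left; exact ZMod.val_add_of_lt h
    · right; exact (ZMod.val_add_val_of_le h).symm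
  have hxy := hx.trans hy.symm
  have h1 := congrArg Prod.fst hxy
  have h2 := congrArg Prod.snd hxy
  simp only [quadHalf, Prod.fst_sub, Prod.snd_sub] at h1 h2
  have e01 : (0 : ZMod 3) - 0 ≠ 0 - 1 ∧ (0 : ZMod 3) - 0 ≠ 1 - 0 ∧ (1 : ZMod 3) - 1 ≠ 0 - 1 ∧
    (1 : ZMod 3) - 1 ≠ 1 - 0 ∧ (0 : ZMod 3) - 1 ≠ 1 - 0 := by decide
  obtain ⟨e1, e2, e3, e4, e5⟩ := e01
  have hdiff : ((x + a).val : ℤ) - x.val = (y + a).val - y.val := by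
    have kx := key x
    have ky := key y
    split_ifs at h2 <;>
      first
      | omega
      | exact absurd h2 (by assumption)
      | exact absurd h2.symm (by assumption)
  apply ZMod.val_injective d
  have kx := key x
  obtain ⟨k, hk⟩ : ∃ k : ℤ, k = (x + a).val - x.val := ⟨_, rfl⟩
  have q1 : ((x + a).val : ℤ) = x.val + k := by omega
  have q2 : ((y + a).val : ℤ) = y.val + k := by omega
  rw [q1, q2] at h1
  have := quad_aux d p hd hp hdp x.val y.val k (by omega) (by rw [abs_lt]; omega)
    (by rw [abs_lt]; omega) h1
  exact_mod_cast this

/-- Theorem 4 of the paper: `𝐂(d) = O(d)`, i.e. there is a constant `c > 0` with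
`𝐂(d) ≤ c·d` for every `d ≥ 2`. -/
theorem C_linear : ∃ c : ℝ, 0 < c ∧ ∀ d : ℕ, 2 ≤ d → (Cd1u d : ℝ) ≤ c * d := by
  refine ⟨6, by norm_num, fun d hd => ?_⟩
  obtain ⟨p, hp, hdp, hp2⟩ := Nat.exists_prime_lt_and_le_two_mul d (by omega)
  haveI : NeZero p := ⟨hp.ne_zero⟩
  have h : Cd1u d ≤ p * 3 := by
    apply Nat.sInf_le
    refine ⟨ZMod p × ZMod 3, inferInstance, inferInstance, ?_, quadHalf d p,
      quadHalf_isD1U d p hd hp hdp⟩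
    simp [ZMod.card]
  have h' : Cd1u d ≤ 6 * d := by omega
  exact_mod_cast h'
end

section
/- For every odd integer d ≥ 3, one has 𝐂(d) ≤ 4d. (This follows from the bound 𝐂(d) ≤ 2·𝐂(q) for q an odd prime with d − 1 ≤ q < 2d, whose existence is guaranteed by Bertrand's postulate, together with 𝐂(q) = q for odd primes q.) -/
/-- For every odd `d ≥ 3`, `𝐂(d) ≤ 4d` (via Bertrand's postulate: an odd prime `q` with
`d - 1 ≤ q < 2d` exists, `𝐂(q) = q`, and `𝐂(d) ≤ 2·𝐂(q)`). -/
theorem C_le_four_mul_of_odd (d : ℕ) (hd : 3 ≤ d) (hodd : Odd d) :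
    Cd1u d ≤ 4 * d := by
  obtain ⟨q, hq, hdq, hq2⟩ := Nat.exists_prime_lt_and_le_two_mul d (by omega)
  haveI : NeZero d := ⟨by omega⟩
  haveI : NeZero q := ⟨by omega⟩
  have hmem : 2 * q ∈ {n : ℕ | ∃ (B : Type) (_ : AddCommGroup B) (_ : Fintype B),
      Fintype.card B = n ∧ ∃ f : ZMod d → B, IsD1U f} := by
    refine ⟨ZMod 2 × ZMod q, inferInstance, inferInstance, ?_,
      fun x => (((x.val : ℤ) : ZMod 2), (((x.val : ℤ) ^ 2 : ℤ) : ZMod q)), ?_⟩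
    · simp [ZMod.card]
    intro a b hab x y hx hy
    by_cases ha : a = 0
    · subst ha
      exfalso
      apply hab
      rw [← hx]
      simp
    have hav : a.val ≠ 0 := by rwa [Ne, ZMod.val_eq_zero]
    have hal := ZMod.val_lt a
    have hxl := ZMod.val_lt x
    have hyl := ZMod.val_lt y
    have h := hx.trans hy.symm
    simp only [Prod.mk_sub_mk, Prod.mk.injEq, ← Int.cast_sub] at h
    obtain ⟨h1, h2⟩ := h
    rw [ZMod.intCast_eq_intCast_iff_dvd_sub] at h1 h2
    have wrap : ∀ z : ZMod d, (((z + a).val : ℤ) = z.val + a.val ∨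
        ((z + a).val : ℤ) = z.val + a.val - d) := by
      intro z
      have hzl := ZMod.val_lt z
      rw [ZMod.val_add]
      rcases lt_or_ge (z.val + a.val) d with h | h
      · left
        rw [Nat.mod_eq_of_lt h]; push_cast; rfl
      · right
        rw [Nat.mod_eq_sub_mod h, Nat.mod_eq_of_lt (by omega)]
        omega
    obtain ⟨m, hm⟩ := hodd
    have key : ∃ k : ℤ, k ≠ 0 ∧ |k| < q ∧ ((x + a).val : ℤ) = x.val + k ∧
        ((y + a).val : ℤ) = y.val + k := by
      rcases wrap x with hx' | hx' <;> rcases wrap y with hy' | hy'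
      · exact ⟨a.val, by omega, by rw [abs_lt]; omega, hx', hy'⟩
      · omega
      · omega
      · exact ⟨a.val - d, by omega, by rw [abs_lt]; omega, by omega, by omega⟩
    obtain ⟨k, hk0, hkq, hxk, hyk⟩ := key
    rw [hxk, hyk] at h2
    have h3 : (q : ℤ) ∣ 2 * (k * ((y.val : ℤ) - x.val)) := by
      convert h2 using 1
      ring
    have hqp : Prime (q : ℤ) := Nat.prime_iff_prime_int.mp hq
    have h4 : (y.val : ℤ) - x.val = 0 := by
      rcases hqp.dvd_or_dvd h3 with h | h
      · have := Int.le_of_dvd (by norm_num) h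
        omega
      rcases hqp.dvd_or_dvd h with h | h
      · exact absurd (Int.eq_zero_of_abs_lt_dvd h hkq) hk0
      · exact Int.eq_zero_of_abs_lt_dvd h (by rw [abs_lt]; omega)
    apply ZMod.val_injective d
    omega
  calc Cd1u d ≤ 2 * q := Nat.sInf_le hmem
    _ ≤ 4 * d := by omega
end

section
/- Let θ = 0.525. There exists a positive integer N such that for every even integer d ≥ N, the inequality 𝐂(d) ≤ 3(d + d^θ) holds (as an inequality of real numbers, with d^θ the real power). -/
lemma fac_lower (m : ℕ) :
    5 ^ m * ((4 * m).factorial * (3 * m).factorial) ≤ (6 * m).factorial * m.factorial := by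
  induction m with
  | zero => simp
  | succ m ih =>
    have e4 : (4 * (m + 1)).factorial
        = (4*m+4)*((4*m+3)*((4*m+2)*((4*m+1)*(4*m).factorial))) := by
      rw [show 4 * (m + 1) = 4*m+1+1+1+1 by ring]; simp only [Nat.factorial_succ]
    have e3 : (3 * (m + 1)).factorial
        = (3*m+3)*((3*m+2)*((3*m+1)*(3*m).factorial)) := by
      rw [show 3 * (m + 1) = 3*m+1+1+1 by ring]; simp only [Nat.factorial_succ]
    have e6 : (6 * (m + 1)).factorial
        = (6*m+6)*((6*m+5)*((6*m+4)*((6*m+3)*((6*m+2)*((6*m+1)*(6*m).factorial))))) := by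
      rw [show 6 * (m + 1) = 6*m+1+1+1+1+1+1 by ring]; simp only [Nat.factorial_succ]
    rw [e4, e3, e6, Nat.factorial_succ]
    have key : 5 * ((4*m+3)*(4*m+2)*(4*m+1)) ≤ 2 * ((6*m+5)*(6*m+3)*(6*m+1)) := by
      ring_nf; nlinarith
    have := Nat.mul_le_mul_left (4 * (m+1) * ((3*m+3)*(3*m+2)*(3*m+1))) (Nat.mul_le_mul key ih)
    calc _ = _ := ?_
      _ ≤ _ := this
      _ = _ := ?_
    · ring
    · ring

def Dexp (m p : ℕ) : ℕ :=
  if p ≤ Nat.sqrt (6 * m) then Nat.log p (6 * m) else if p ≤ m then 1 else 0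

def Dprod (m : ℕ) : ℕ := ∏ p ∈ (Finset.range (6 * m + 1)).filter Nat.Prime, p ^ Dexp m p

lemma Dprod_pos (m : ℕ) : 0 < Dprod m := by
  apply Finset.prod_pos
  intro p hp
  exact pow_pos (Finset.mem_filter.1 hp).2.pos _

lemma Dprod_le (m : ℕ) (hm : 0 < m) : Dprod m ≤ (6 * m) ^ Nat.sqrt (6 * m) * 4 ^ m := by
  have h1 : Dprod m ≤ (∏ p ∈ (Finset.range (6 * m + 1)).filter Nat.Prime,
        if p ≤ Nat.sqrt (6*m) then 6*m else 1) *
      ∏ p ∈ (Finset.range (6 * m + 1)).filter Nat.Prime, if p ≤ m then p else 1 := by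
    rw [← Finset.prod_mul_distrib]
    apply Finset.prod_le_prod'
    intro p hp
    have hpp := (Finset.mem_filter.1 hp).2
    unfold Dexp
    split_ifs with h1 h2 h2
    · calc _ ≤ 6 * m := Nat.pow_log_le_self p (by omega)
        _ ≤ _ := Nat.le_mul_of_pos_right _ hpp.pos
    · simpa using Nat.pow_log_le_self p (by omega)
    · simp
    · simp
  refine h1.trans (Nat.mul_le_mul ?_ ?_)
  · rw [← Finset.prod_filter, Finset.prod_const]
    apply Nat.pow_le_pow_right (by omega)
    calc _ ≤ (Finset.Icc 1 (Nat.sqrt (6*m))).card := by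
          apply Finset.card_le_card
          intro p hp
          simp only [Finset.mem_filter, Finset.mem_range] at hp
          simp [hp.2, hp.1.2.pos]
          exact hp.1.2.pos
      _ = _ := by simp
  · rw [← Finset.prod_filter]
    refine le_trans (le_of_eq ?_) (primorial_le_four_pow m)
    unfold primorial
    apply Finset.prod_congr _ (fun _ _ => rfl)
    ext p
    simp only [Finset.mem_filter, Finset.mem_range]
    constructor
    · rintro ⟨⟨_, h⟩, h'⟩; exact ⟨by omega, h⟩
    · rintro ⟨h, h'⟩; exact ⟨⟨by omega, h'⟩, by omega⟩

lemma div_ineq1 (m q : ℕ) : 6 * m / q + m / q ≤ 4 * m / q + 3 * m / q + 1 := by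
  rcases Nat.eq_zero_or_pos q with rfl | hq
  · simp
  have hr := Nat.mod_lt m hq
  obtain ⟨k, r, hk, hr⟩ : ∃ k r, m = q * k + r ∧ r < q :=
    ⟨m / q, m % q, (Nat.div_add_mod m q).symm, hr⟩
  have e (c : ℕ) : c * m / q = c * k + c * r / q := by
    rw [hk, show c * (q * k + r) = c * r + q * (c * k) by ring, Nat.add_mul_div_left _ _ hq]; ring
  have e1 := e 1
  rw [one_mul, one_mul, one_mul, Nat.div_eq_of_lt hr] at e1
  rw [e, e, e, e1]
  have a6 := Nat.div_mul_le_self (6 * r) q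
  have a4 := Nat.lt_div_mul_add (a := 4 * r) hq
  have a3 := Nat.lt_div_mul_add (a := 3 * r) hq
  have h6 : 6 * r / q < 6 := by rw [Nat.div_lt_iff_lt_mul hq]; omega
  generalize 6 * r / q = A at *
  generalize 4 * r / q = B at *
  generalize 3 * r / q = C at *
  by_contra hcon
  have hA : B + C + 2 ≤ A := by omega
  interval_cases A <;> (try omega) <;>
  · have hB : B ≤ 3 := by omega
    have hC : C ≤ 3 := by omega
    interval_cases B <;> interval_cases C <;> omega

lemma div_ineq2 (m q : ℕ) (h : m < q) (h2 : q ≤ 4 * m ∨ 6 * m < q) :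
    6 * m / q + m / q ≤ 4 * m / q + 3 * m / q := by
  have hq : 0 < q := by omega
  rw [Nat.div_eq_of_lt h]
  have a6 := Nat.div_mul_le_self (6 * m) q
  have a4 := Nat.lt_div_mul_add (a := 4 * m) hq
  have a3 := Nat.lt_div_mul_add (a := 3 * m) hq
  have h6 : 6 * m / q < 6 := by rw [Nat.div_lt_iff_lt_mul hq]; omega
  generalize 6 * m / q = A at *
  generalize 4 * m / q = B at *
  generalize 3 * m / q = C at *
  by_contra hcon
  have hA : B + C + 1 ≤ A := by omega
  have hB : B ≤ 4 := by omega
  have hC : C ≤ 4 := by omega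
  interval_cases A <;> interval_cases B <;> (try omega) <;> interval_cases C <;> omega

lemma fac_dvd (m : ℕ) (hm : 0 < m) (hno : ∀ p, p.Prime → 4 * m < p → ¬ p ≤ 6 * m) :
    (6 * m).factorial * m.factorial ∣ ((4 * m).factorial * (3 * m).factorial) * Dprod m := by
  have f (n : ℕ) : n.factorial ≠ 0 := n.factorial_ne_zero
  rw [← Nat.factorization_le_iff_dvd (mul_ne_zero (f _) (f _))
    (mul_ne_zero (mul_ne_zero (f _) (f _)) (Dprod_pos m).ne')]
  intro p
  by_cases hp : p.Prime
  swap
  · simp [Nat.factorization_eq_zero_of_not_prime _ hp]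
  rw [Nat.factorization_mul (f _) (f _), Nat.factorization_mul (mul_ne_zero (f _) (f _))
    (Dprod_pos m).ne', Nat.factorization_mul (f _) (f _)]
  simp only [Finsupp.add_apply]
  have hlog (n : ℕ) (hn : n ≤ 6 * m) : Nat.log p n < Nat.log p (6 * m) + 1 :=
    Nat.lt_succ_of_le (Nat.log_mono_right hn)
  rw [Nat.factorization_factorial hp (hlog (6 * m) le_rfl),
    Nat.factorization_factorial hp (hlog m (by omega)),
    Nat.factorization_factorial hp (hlog (4 * m) (by omega)),
    Nat.factorization_factorial hp (hlog (3 * m) (by omega)),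
    ← Finset.sum_add_distrib, ← Finset.sum_add_distrib]
  by_cases hp6 : 6 * m < p
  · rw [Nat.log_of_lt hp6]; simp
  have hD : Dexp m p ≤ (Dprod m).factorization p := by
    rw [← hp.pow_dvd_iff_le_factorization (Dprod_pos m).ne']
    exact Finset.dvd_prod_of_mem (fun p => p ^ Dexp m p)
      (Finset.mem_filter.2 ⟨Finset.mem_range.2 (by omega), hp⟩)
  refine le_trans ?_ (Nat.add_le_add_left hD _)
  unfold Dexp
  split_ifs with h1 h2
  · calc _ ≤ ∑ i ∈ Finset.Ico 1 (Nat.log p (6*m) + 1),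
          (4 * m / p ^ i + 3 * m / p ^ i + 1) := Finset.sum_le_sum fun i _ => div_ineq1 m (p ^ i)
      _ = _ := by rw [Finset.sum_add_distrib]; simp
  all_goals
    have hl : Nat.log p (6 * m) = 1 := by
      have h3 : 6 * m < p ^ 2 := by
        rw [pow_two]; exact Nat.sqrt_lt.1 (by omega)
      have := Nat.log_lt_of_lt_pow (by omega) h3
      have := Nat.log_pos hp.one_lt (show p ≤ 6 * m by omega)
      omega
    rw [hl]
    simp only [Nat.reduceAdd, Nat.Ico_succ_singleton, Finset.sum_singleton, pow_one]
  · exact div_ineq1 m p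
  · have := hno p hp
    exact div_ineq2 m p (by omega) (by omega)

lemma exists_prime_46 : ∃ M : ℕ, ∀ m ≥ M, ∃ p, p.Prime ∧ 4 * m < p ∧ p ≤ 6 * m := by
  have hc : (0:ℝ) < Real.log (5/4) / 7 := div_pos (Real.log_pos (by norm_num)) (by norm_num)
  have h := (isLittleO_log_rpow_atTop (r := 1/2) (by norm_num)).bound hc
  obtain ⟨X, hX⟩ := Filter.eventually_atTop.1 h
  refine ⟨⌈X⌉₊ + 1, fun m hm => ?_⟩
  by_contra hcon
  push Not at hcon
  have hm0 : 0 < m := by omega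
  have hd := Nat.le_of_dvd (Nat.mul_pos (Nat.mul_pos (Nat.factorial_pos _) (Nat.factorial_pos _))
    (Dprod_pos m)) (fac_dvd m hm0 (fun p hp h => by have := hcon p hp h; omega))
  have h5 : 5 ^ m ≤ (6 * m) ^ Nat.sqrt (6 * m) * 4 ^ m := by
    refine le_trans ?_ (Dprod_le m hm0)
    have := (fac_lower m).trans hd
    rw [mul_comm] at this
    exact Nat.le_of_mul_le_mul_left this (Nat.mul_pos (Nat.factorial_pos _) (Nat.factorial_pos _))
  have h6 : (5:ℝ) ^ m ≤ (6 * m : ℝ) ^ Nat.sqrt (6 * m) * 4 ^ m := by exact_mod_cast h5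
  have hmr : (0:ℝ) < 6 * m := by positivity
  have h7 := Real.log_le_log (by positivity) h6
  rw [Real.log_mul (by positivity) (by positivity), Real.log_pow, Real.log_pow, Real.log_pow] at h7
  have hXm : X ≤ 6 * (m:ℝ) := by
    have h1 := Nat.le_ceil X
    have h2 : ((⌈X⌉₊ + 1 : ℕ) : ℝ) ≤ m := by exact_mod_cast hm
    push_cast at h2
    linarith
  have h8 := hX _ hXm
  rw [← Real.sqrt_eq_rpow, Real.norm_eq_abs, Real.norm_of_nonneg (Real.sqrt_nonneg _)] at h8
  have h9 : Real.log (6 * m) ≤ Real.log (5/4) / 7 * √(6 * m) := (le_abs_self _).trans h8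
  have h10 : (Nat.sqrt (6 * m) : ℝ) ≤ √(6 * m) := by
    have := Real.nat_sqrt_le_real_sqrt (a := 6 * m)
    push_cast at this; exact this
  have hl0 : 0 ≤ Real.log (6 * m) := Real.log_nonneg (by
    have : (1:ℝ) ≤ m := by exact_mod_cast hm0
    linarith)
  have h11 : (Nat.sqrt (6 * m) : ℝ) * Real.log (6 * m) ≤ Real.log (5/4) / 7 * (6 * m) := by
    calc _ ≤ √(6 * m) * (Real.log (5/4) / 7 * √(6 * m)) :=
          mul_le_mul h10 h9 hl0 (Real.sqrt_nonneg _)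
      _ = Real.log (5/4) / 7 * (√(6 * m) * √(6 * m)) := by ring
      _ = _ := by rw [Real.mul_self_sqrt hmr.le]
  have h12 : Real.log (5/4) = Real.log 5 - Real.log 4 := Real.log_div (by norm_num) (by norm_num)
  have h13 : (0:ℝ) < m * Real.log (5/4) := mul_pos (by positivity) (by linarith)
  have : (m:ℝ) * Real.log (5/4) = m * Real.log 5 - m * Real.log 4 := by rw [h12]; ring
  linarith

/-- Component sign/power function. -/
def sgnPow {p : ℕ} (g : ZMod p) (e n : ℕ) : ZMod 2 × ZMod p :=
  ((n / e : ℕ), (-1) ^ (n / e) * g ^ (n % e))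

lemma pair_eq {F : Type} [Field F] {X W Y Z : F} (hs : X + W = Y + Z) (hp : X * W = Y * Z) :
    X = Y ∨ X = Z := by
  have : (X - Y) * (X - Z) = 0 := by linear_combination X * hs - hp
  rcases mul_eq_zero.1 this with h | h
  · exact Or.inl (sub_eq_zero.1 h)
  · exact Or.inr (sub_eq_zero.1 h)

lemma sgnPow_inj {p : ℕ} [Fact p.Prime] (g : ZMod p) (e : ℕ) (he : 0 < e) (hpe : 2 * e < p)
    (hg : orderOf g = p - 1) {m n : ℕ} (hm : m < 2 * e) (hn : n < 2 * e)
    (h : (-1 : ZMod p) ^ (m / e) * g ^ (m % e) = (-1) ^ (n / e) * g ^ (n % e)) : m = n := by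
  have hme := Nat.mod_lt m he
  have hne := Nat.mod_lt n he
  have h2 : g ^ (2 * (m % e)) = g ^ (2 * (n % e)) := by
    have := congrArg (fun t => t ^ 2) h
    simp only [mul_pow, ← pow_mul, mul_comm _ 2] at this
    simpa [pow_mul] using this
  have h3 := pow_injOn_Iio_orderOf (x := g) (by simp only [Set.mem_Iio, hg]; omega)
    (by simp only [Set.mem_Iio, hg]; omega) h2
  have h4 : m % e = n % e := by omega
  have hg0 : g ≠ 0 := by
    rintro rfl
    rw [orderOf_zero] at hg
    omega
  rw [h4] at h
  have h5 := mul_right_cancel₀ (pow_ne_zero _ hg0) h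
  have hm2 : m / e < 2 := by rw [Nat.div_lt_iff_lt_mul he]; exact hm
  have hn2 : n / e < 2 := by rw [Nat.div_lt_iff_lt_mul he]; exact hn
  haveI : Fact (2 < p) := ⟨by omega⟩
  have hne1 := ZMod.neg_one_ne_one (n := p)
  have h6 : m / e = n / e := by
    clear h
    generalize m / e = a at h5 hm2 ⊢
    generalize n / e = b at h5 hn2 ⊢
    interval_cases a <;> interval_cases b
    · rfl
    · exact absurd (by simpa using h5.symm) hne1
    · exact absurd (by simpa using h5) hne1
    · rfl
  rw [← Nat.div_add_mod m e, ← Nat.div_add_mod n e, h4, h6]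

lemma sidon {p : ℕ} [Fact p.Prime] (g : ZMod p) (e : ℕ) (he : 0 < e) (hpe : 2 * e < p)
    (hg : orderOf g = p - 1) {x w y z : ℕ} (hx : x < 2 * e) (hw : w < 2 * e) (hy : y < 2 * e)
    (hz : z < 2 * e) (hs : x + w ≡ y + z [MOD 2 * e])
    (hf : sgnPow g e x + sgnPow g e w = sgnPow g e y + sgnPow g e z) : x = y ∨ x = z := by
  have hf1 := congrArg Prod.fst hf
  have hf2 := congrArg Prod.snd hf
  simp only [sgnPow, Prod.fst_add, Prod.snd_add] at hf1 hf2
  rw [← Nat.cast_add, ← Nat.cast_add, ZMod.natCast_eq_natCast_iff] at hf1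
  have h1 : e * (x / e + w / e) ≡ e * (y / e + z / e) [MOD 2 * e] := by
    rw [mul_comm 2 e]; exact Nat.ModEq.mul_left' e hf1
  have h2 : x % e + w % e ≡ y % e + z % e [MOD 2 * e] := by
    apply Nat.ModEq.add_left_cancel h1
    have hx' := Nat.div_add_mod x e
    have hy' := Nat.div_add_mod y e
    have hz' := Nat.div_add_mod z e
    have hw' := Nat.div_add_mod w e
    convert hs using 1 <;> linarith
  have bx := Nat.mod_lt x he
  have bw := Nat.mod_lt w he
  have bY := Nat.mod_lt y he
  have bz := Nat.mod_lt z he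
  have h3 : x % e + w % e = y % e + z % e := Nat.ModEq.eq_of_lt_of_lt h2 (by omega) (by omega)
  have h4 : (-1 : ZMod p) ^ (x / e + w / e) = (-1) ^ (y / e + z / e) := by
    rw [neg_one_pow_eq_pow_mod_two, hf1, ← neg_one_pow_eq_pow_mod_two]
  have h5 := pair_eq hf2 (by
    calc _ = (-1 : ZMod p) ^ (x / e + w / e) * g ^ (x % e + w % e) := by rw [pow_add, pow_add]; ring
      _ = (-1 : ZMod p) ^ (y / e + z / e) * g ^ (y % e + z % e) := by rw [h4, h3]
      _ = _ := by rw [pow_add, pow_add]; ring)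
  rcases h5 with h | h
  · exact Or.inl (sgnPow_inj g e he hpe hg hx hy h)
  · exact Or.inr (sgnPow_inj g e he hpe hg hx hz h)

lemma Cd1u_le (e p : ℕ) (he : 0 < e) (hp : p.Prime) (hpe : 2 * e < p) : Cd1u (2 * e) ≤ 2 * p := by
  haveI : Fact p.Prime := ⟨hp⟩
  haveI : NeZero (2 * e) := ⟨by omega⟩
  obtain ⟨u, hu⟩ := IsCyclic.exists_generator (α := (ZMod p)ˣ)
  have ho := orderOf_eq_card_of_forall_mem_zpowers hu
  rw [Nat.card_eq_fintype_card, ZMod.card_units] at ho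
  have hg : orderOf (u : ZMod p) = p - 1 := by rw [orderOf_units, ho]
  apply Nat.sInf_le
  refine ⟨ZMod 2 × ZMod p, inferInstance, inferInstance, by simp [ZMod.card],
    fun x => sgnPow (u : ZMod p) e x.val, ?_⟩
  intro a b hab x y hx hy
  have hs : (x + a) + y = (y + a) + x := by abel
  have h := sidon (u : ZMod p) e he hpe hg (x := (x + a).val) (w := y.val) (y := (y + a).val)
    (z := x.val) (ZMod.val_lt _) (ZMod.val_lt _) (ZMod.val_lt _) (ZMod.val_lt _)
    (by
      rw [← ZMod.natCast_eq_natCast_iff]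
      simpa using hs)
    (by
      have := hx.trans hy.symm
      rw [sub_eq_sub_iff_add_eq_add] at this
      exact this)
  rcases h with h | h
  · exact add_right_cancel (ZMod.val_injective _ h)
  · have h1 : x + a = x := ZMod.val_injective _ h
    have ha : a = 0 := by simpa using h1
    exfalso
    apply hab
    subst ha
    simp at hx
    rw [← hx]

/-- Corollary 6(2) of the paper: with `θ = 0.525` (Baker–Harman–Pintz), for all sufficiently
large even `d` one has `𝐂(d) ≤ 3(d + d^θ)`. -/
theorem C_asymptotic_even :
    ∃ N : ℕ, 0 < N ∧ ∀ d : ℕ, N ≤ d → Even d →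
      (Cd1u d : ℝ) ≤ 3 * ((d : ℝ) + (d : ℝ) ^ (0.525 : ℝ)) := by
  obtain ⟨M, hM⟩ := exists_prime_46
  refine ⟨4 * M + 4, by omega, fun d hd hev => ?_⟩
  obtain ⟨e, rfl⟩ := hev
  rw [← two_mul] at hd ⊢
  obtain ⟨p, hp, h1, h2⟩ := hM ((e + 1) / 2) (by omega)
  have h3 := Cd1u_le e p (by omega) hp (by omega)
  have h4 : Cd1u (2 * e) ≤ 3 * (2 * e) + 6 := by omega
  have h5 : (Cd1u (2 * e) : ℝ) ≤ 3 * ((2 * e : ℕ) : ℝ) + 6 := by exact_mod_cast h4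
  have h6 : (2:ℝ) ≤ ((2 * e : ℕ) : ℝ) ^ (0.525 : ℝ) := by
    have h7 : (4:ℝ) ≤ ((2 * e : ℕ) : ℝ) := by exact_mod_cast (by omega : 4 ≤ 2 * e)
    calc (2:ℝ) = (4:ℝ) ^ (1/2 : ℝ) := by
          rw [← Real.sqrt_eq_rpow, show (4:ℝ) = 2 ^ 2 by norm_num, Real.sqrt_sq (by norm_num)]
      _ ≤ (4:ℝ) ^ (0.525 : ℝ) := Real.rpow_le_rpow_of_exponent_le (by norm_num) (by norm_num)
      _ ≤ _ := Real.rpow_le_rpow (by norm_num) h7 (by norm_num)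
  linarith
end

section
/- If d = p^k − 1 for some prime p and some positive integer k, with d ≥ 2, then 𝐂(d) ≤ d + 1; that is, there exists a differentially 1-uniform function from ℤ/dℤ into some abelian group of order d + 1. -/
/-- Theorem 3(2) of the paper: if `d = p^k - 1 ≥ 2` for a prime `p` and `k ≥ 1`, then
`𝐂(d) ≤ d + 1`: there is a d1u function from `ℤ/dℤ` into some abelian group of order `d + 1`. -/
theorem C_le_succ_of_prime_pow_sub_one (d p k : ℕ) (hp : p.Prime) (hk : 1 ≤ k)
    (hd : d = p ^ k - 1) (hd2 : 2 ≤ d) :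
    Cd1u d ≤ d + 1 ∧
    ∃ (B : Type) (_ : AddCommGroup B) (_ : Fintype B),
      Fintype.card B = d + 1 ∧ ∃ f : ZMod d → B, IsD1U f := by
  have main : ∃ (B : Type) (_ : AddCommGroup B) (_ : Fintype B),
      Fintype.card B = d + 1 ∧ ∃ f : ZMod d → B, IsD1U f := by
    haveI : Fact p.Prime := ⟨hp⟩
    have hk0 : k ≠ 0 := by omega
    have hcard : Nat.card (GaloisField p k) = d + 1 := by
      rw [GaloisField.card p k hk0]; omega
    letI : Fintype (GaloisField p k) := Fintype.ofFinite _
    have hu : Nat.card (GaloisField p k)ˣ = d := by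
      rw [Nat.card_units, hcard]; omega
    let e : Multiplicative (ZMod d) ≃* (GaloisField p k)ˣ :=
      mulEquivOfCyclicCardEq ((Nat.card_congr Multiplicative.toAdd).trans ((Nat.card_zmod d).trans hu.symm))
    have hadd : ∀ x y : ZMod d, e (Multiplicative.ofAdd (x + y)) =
        e (Multiplicative.ofAdd x) * e (Multiplicative.ofAdd y) := by
      intro x y
      rw [ofAdd_add, map_mul]
    refine ⟨GaloisField p k, inferInstance, inferInstance, ?_,
      fun x => ((e (Multiplicative.ofAdd x) : (GaloisField p k)ˣ) : GaloisField p k), ?_⟩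
    · rw [← Nat.card_eq_fintype_card, hcard]
    · intro a b hab x y hx hy
      simp only [hadd, Units.val_mul] at hx hy
      by_cases ha : a = 0
      · subst ha
        simp at hx
        exact absurd (by rw [← hx]) hab
      · have h1 : ((e (Multiplicative.ofAdd a) : (GaloisField p k)ˣ) : GaloisField p k) - 1 ≠ 0 := by
          intro h
          have h2 : e (Multiplicative.ofAdd a) = 1 := Units.ext (by simpa using sub_eq_zero.mp h)
          apply ha
          have h3 := (MulEquiv.map_eq_one_iff e).mp h2
          simpa using h3
        have h4 : ((e (Multiplicative.ofAdd x) : (GaloisField p k)ˣ) : GaloisField p k) =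
            ((e (Multiplicative.ofAdd y) : (GaloisField p k)ˣ) : GaloisField p k) := by
          apply mul_right_cancel₀ h1
          linear_combination hx - hy
        exact Multiplicative.ofAdd.injective (e.injective (Units.ext h4))
  refine ⟨Nat.sInf_le ?_, main⟩
  exact main
end

section
/- 𝐂(20) ≤ 32 and 𝐂(21) ≤ 37: there exist differentially 1-uniform functions from ℤ/20ℤ into some abelian group of order 32, and from ℤ/21ℤ into some abelian group of order 37. -/
theorem isD1U_of_check {A B : Type} [AddCommGroup A] [AddCommGroup B] (f : A → B)
    (h : ∀ a : A, a ≠ 0 → ∀ x y : A, f (x + a) - f x = f (y + a) - f y → x = y) :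
    IsD1U f := by
  intro a b hab x y hx hy
  by_cases ha : a = 0
  · subst ha
    exact absurd (by simpa using hx.symm) (fun hb : b = 0 => hab (by rw [hb]))
  · exact h a ha x y (hx.trans hy.symm)

/-- A d1u function from `ℤ/20ℤ` to `ℤ/32ℤ`. -/
def f20 : Fin 20 → Fin 32 :=
  ![28, 24, 11, 12, 21, 29, 14, 4, 17, 15, 3, 13, 8, 26, 17, 17, 16, 23, 12, 24]

/-- A d1u function from `ℤ/21ℤ` to `ℤ/37ℤ`. -/
def f21 : Fin 21 → Fin 37 :=
  ![27, 23, 21, 28, 7, 29, 17, 1, 28, 36, 17, 6, 19, 21, 15, 21, 18, 18, 35, 13, 4]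

theorem f20_check : ∀ a : Fin 20, a ≠ 0 → ∀ x y : Fin 20,
    f20 (x + a) - f20 x = f20 (y + a) - f20 y → x = y := by
  decide +kernel

theorem f21_check : ∀ a : Fin 21, a ≠ 0 → ∀ x y : Fin 21,
    f21 (x + a) - f21 x = f21 (y + a) - f21 y → x = y := by
  decide +kernel

theorem exists_20 : ∃ (B : Type) (_ : AddCommGroup B) (_ : Fintype B),
    Fintype.card B = 32 ∧ ∃ f : ZMod 20 → B, IsD1U f :=
  ⟨ZMod 32, inferInstance, inferInstance, ZMod.card 32,
    (f20 : ZMod 20 → ZMod 32), isD1U_of_check _ f20_check⟩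

theorem exists_21 : ∃ (B : Type) (_ : AddCommGroup B) (_ : Fintype B),
    Fintype.card B = 37 ∧ ∃ f : ZMod 21 → B, IsD1U f :=
  ⟨ZMod 37, inferInstance, inferInstance, ZMod.card 37,
    (f21 : ZMod 21 → ZMod 37), isD1U_of_check _ f21_check⟩

/-- Computer findings: `𝐂(20) ≤ 32` and `𝐂(21) ≤ 37`: there are d1u functions from `ℤ/20ℤ`
into an abelian group of order `32`, and from `ℤ/21ℤ` into an abelian group of order `37`. -/
theorem C_twenty_le_and_twentyone_le :
    (Cd1u 20 ≤ 32 ∧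
      ∃ (B : Type) (_ : AddCommGroup B) (_ : Fintype B),
        Fintype.card B = 32 ∧ ∃ f : ZMod 20 → B, IsD1U f) ∧
    (Cd1u 21 ≤ 37 ∧
      ∃ (B : Type) (_ : AddCommGroup B) (_ : Fintype B),
        Fintype.card B = 37 ∧ ∃ f : ZMod 21 → B, IsD1U f) := by
  exact ⟨⟨Nat.sInf_le exists_20, exists_20⟩, ⟨Nat.sInf_le exists_21, exists_21⟩⟩
end
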